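/- Let w be a weight on ℝ^{n+1} and assume there exists a constant C > 0 such that w(R^−) ≤ C w(R^+) for every parabolic rectangle R ⊂ ℝ^{n+1}. Then there exists a constant c > 0 (depending on n, p, C) such that for every parabolic rectangle R and every λ ≥ w_{R^+}, w(R^− ∩ {w > λ}) ≤ c λ |R^− ∩ {M^+w > λ}|. -/

import Mathlib

open MeasureTheory Set ENNReal

noncomputable section

/-- The spatial cube `Q(x,L)` with center `x` and side length `L`. -/
def parQ (n : ℕ) (x : Fin n → ℝ) (L : ℝ) : Set (Fin n → ℝ) :=
  {y | ∀ i, |y i - x i| ≤ L / 2}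

/-- Lower part `R^-(γ)` of the parabolic rectangle `R(x,t,L)`. -/
def pMinus (n : ℕ) (p γ : ℝ) (x : Fin n → ℝ) (t L : ℝ) : Set ((Fin n → ℝ) × ℝ) :=
  (parQ n x L) ×ˢ Set.Ioo (t - L ^ p) (t - γ * L ^ p)

/-- Upper part `R^+(γ)` of the parabolic rectangle `R(x,t,L)`. -/
def pPlus (n : ℕ) (p γ : ℝ) (x : Fin n → ℝ) (t L : ℝ) : Set ((Fin n → ℝ) × ℝ) :=
  (parQ n x L) ×ˢ Set.Ioo (t + γ * L ^ p) (t + L ^ p)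

/-- The full parabolic rectangle `R(x,t,L)`. -/
def pRect (n : ℕ) (p : ℝ) (x : Fin n → ℝ) (t L : ℝ) : Set ((Fin n → ℝ) × ℝ) :=
  (parQ n x L) ×ˢ Set.Ioo (t - L ^ p) (t + L ^ p)

/-- A weight: a nonnegative locally integrable function on `ℝ^{n+1}`. -/
def IsWeight (n : ℕ) (w : (Fin n → ℝ) × ℝ → ℝ) : Prop :=
  (∀ z, 0 ≤ w z) ∧ MeasureTheory.LocallyIntegrable w volume

/-- The uncentered forward-in-time parabolic maximal function. -/
def Mplus (n : ℕ) (p : ℝ) (f : (Fin n → ℝ) × ℝ → ℝ) (z : (Fin n → ℝ) × ℝ) : ℝ≥0∞ :=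
  ⨆ (x : Fin n → ℝ) (t : ℝ) (L : ℝ) (_ : 0 < L) (_ : z ∈ pMinus n p 0 x t L),
    ENNReal.ofReal (⨍ y in pPlus n p 0 x t L, |f y|)

open Filter Topology Metric

variable {n : ℕ} {p : ℝ}

/-- The space `ℝ^n × ℝ`, to be equipped with the parabolic metric. -/
def ParabolicSpace (n : ℕ) (p : ℝ) (_ : 1 < p) : Type := (Fin n → ℝ) × ℝ

namespace ParabolicSpace

variable {hp : 1 < p}

instance : MeasureSpace (ParabolicSpace n p hp) :=
  inferInstanceAs (MeasureSpace ((Fin n → ℝ) × ℝ))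

instance : TopologicalSpace (ParabolicSpace n p hp) :=
  inferInstanceAs (TopologicalSpace ((Fin n → ℝ) × ℝ))

/-- The identification of parabolic space with a product involving a snowflaked time axis. -/
def toProd (z : ParabolicSpace n p hp) :
    (Fin n → ℝ) × Snowflaking ℝ p⁻¹ (inv_pos.2 (one_pos.trans hp)) (inv_le_one_of_one_le₀ hp.le) :=
  (z.1, Snowflaking.toSnowflaking z.2)

theorem isInducing_toProd : IsInducing (toProd : ParabolicSpace n p hp → _) :=
  IsInducing.id.prodMap Snowflaking.homeomorph.symm.isInducing

instance : PseudoMetricSpace (ParabolicSpace n p hp) :=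
  isInducing_toProd.comapPseudoMetricSpace

instance : SecondCountableTopology (ParabolicSpace n p hp) :=
  inferInstanceAs (SecondCountableTopology ((Fin n → ℝ) × ℝ))

instance : BorelSpace (ParabolicSpace n p hp) :=
  inferInstanceAs (BorelSpace ((Fin n → ℝ) × ℝ))

instance : IsLocallyFiniteMeasure (volume : Measure (ParabolicSpace n p hp)) :=
  inferInstanceAs (IsLocallyFiniteMeasure (volume : Measure ((Fin n → ℝ) × ℝ)))

theorem closedBall_eq (z : ParabolicSpace n p hp) {r : ℝ} (hr : 0 ≤ r) :
    closedBall z r = closedBall z.1 r ×ˢ closedBall z.2 (r ^ p) := by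
  have hp0 : 0 < p := one_pos.trans hp
  ext y
  change max (dist y.1 z.1) (dist y.2 z.2 ^ p⁻¹) ≤ r ↔ dist y.1 z.1 ≤ r ∧ dist y.2 z.2 ≤ r ^ p
  rw [max_le_iff, Real.rpow_inv_le_iff_of_pos dist_nonneg hr hp0]

theorem volume_closedBall (z : ParabolicSpace n p hp) {r : ℝ} (hr : 0 ≤ r) :
    volume (closedBall z r) = ENNReal.ofReal ((2 * r) ^ n * (2 * r ^ p)) := by
  rw [closedBall_eq z hr]
  change (volume : Measure ((Fin n → ℝ) × ℝ)) _ = _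
  rw [Measure.volume_eq_prod, Measure.prod_prod, Real.volume_pi_closedBall _ hr,
    Real.volume_closedBall, Fintype.card_fin, ← ENNReal.ofReal_mul (by positivity)]

end ParabolicSpace

theorem parQ_eq_pi (x : Fin n → ℝ) (L : ℝ) :
    parQ n x L = univ.pi fun i => Icc (x i - L / 2) (x i + L / 2) := by
  ext y
  simp only [parQ, mem_ofPred_eq, mem_univ_pi, mem_Icc, abs_le]
  exact forall_congr' fun i => by constructor <;> rintro ⟨h₁, h₂⟩ <;> constructor <;> linarith

theorem parQ_eq_closedBall (x : Fin n → ℝ) {L : ℝ} (hL : 0 ≤ L) :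
    parQ n x L = closedBall x (L / 2) := by
  ext y
  simp only [parQ, mem_ofPred_eq, mem_closedBall, dist_pi_le_iff (div_nonneg hL zero_le_two),
    Real.dist_eq]

theorem volume_parQ (x : Fin n → ℝ) {L : ℝ} (hL : 0 ≤ L) :
    volume (parQ n x L) = ENNReal.ofReal (L ^ n) := by
  rw [parQ_eq_closedBall x hL, Real.volume_pi_closedBall _ (by positivity), Fintype.card_fin]
  congr 2; ring

theorem volume_parQ_prod (x : Fin n → ℝ) {L : ℝ} (hL : 0 ≤ L) (a b : ℝ) :
    volume (parQ n x L ×ˢ Ioo a b) = ENNReal.ofReal (L ^ n * (b - a)) := by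
  rw [Measure.volume_eq_prod, Measure.prod_prod, volume_parQ x hL, Real.volume_Ioo,
    ← ENNReal.ofReal_mul (by positivity)]

/-- **Lebesgue differentiation** along the upper parts of parabolic rectangles. -/
theorem ae_tendsto_average_pPlus (hp : 1 < p) {w : (Fin n → ℝ) × ℝ → ℝ}
    (hw : LocallyIntegrable w volume) :
    ∀ᵐ z, ∀ (x : ℕ → Fin n → ℝ) (t L : ℕ → ℝ), (∀ k, 0 < L k) → Tendsto L atTop (𝓝 0) →
      (∀ k, z ∈ pMinus n p 0 (x k) (t k) (L k)) →
      Tendsto (fun k => ⨍ y in pPlus n p 0 (x k) (t k) (L k), w y) atTop (𝓝 (w z)) := by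
  have hp0 : 0 < p := one_pos.trans hp
  let K : NNReal := ⟨12 ^ n * (2 * 6 ^ p), by positivity⟩
  have hK (u : ℝ) : (K : ℝ≥0∞) * ENNReal.ofReal u = ENNReal.ofReal (12 ^ n * (2 * 6 ^ p) * u) := by
    rw [ENNReal.ofReal_mul (by positivity)]; congr 1
    exact (ENNReal.ofReal_coe_nnreal (p := K)).symm
  let v : VitaliFamily (volume : Measure (ParabolicSpace n p hp)) :=
    Vitali.vitaliFamily volume K fun x => by
      refine Eventually.frequently ?_
      filter_upwards [self_mem_nhdsWithin] with r (hr : 0 < r)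
      rw [ParabolicSpace.volume_closedBall x (by positivity),
        ParabolicSpace.volume_closedBall x hr.le, hK]
      refine ENNReal.ofReal_le_ofReal ?_
      have h₁ : (2 * (3 * r)) ^ n ≤ 12 ^ n * (2 * r) ^ n := by
        rw [← mul_pow]; exact pow_le_pow_left₀ (by positivity) (by linarith) n
      have h₂ : (3 * r) ^ p ≤ 6 ^ p * r ^ p := by
        rw [← Real.mul_rpow (by norm_num) hr.le]; gcongr; linarith
      calc _ ≤ 12 ^ n * (2 * r) ^ n * (2 * (6 ^ p * r ^ p)) := by gcongr
        _ ≤ 12 ^ n * (2 * r) ^ n * (2 * (6 ^ p * (2 * r ^ p))) := by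
          gcongr; linarith [Real.rpow_nonneg hr.le p]
        _ = _ := by ring
  have hw' : LocallyIntegrable (X := ParabolicSpace n p hp) w volume := hw
  have key := v.ae_tendsto_average hw'
  change ∀ᵐ z : (Fin n → ℝ) × ℝ, _ at key
  filter_upwards [key] with z hz x t L hL hL0 hzm
  let A : ℕ → Set (ParabolicSpace n p hp) := fun k =>
    parQ n (x k) (L k) ×ˢ Icc (t k) (t k + L k ^ p)
  have hA (k) : A k ⊆ closedBall z (2 * L k) := by
    have hk := hL k
    rw [ParabolicSpace.closedBall_eq z (by positivity)]
    obtain ⟨hz₁, hz₂⟩ := hzm k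
    rintro y ⟨hy₁, hy₂⟩
    rw [parQ_eq_closedBall _ hk.le] at hz₁ hy₁
    refine ⟨?_, ?_⟩
    · have := dist_triangle_right y.1 z.1 (x k)
      rw [mem_closedBall] at hz₁ hy₁ ⊢
      linarith
    · have h2 : 2 * L k ^ p ≤ (2 * L k) ^ p := by
        rw [Real.mul_rpow (by norm_num) hk.le]
        gcongr
        exact Real.self_le_rpow_of_one_le (by norm_num) hp.le
      rw [zero_mul, sub_zero] at hz₂
      rw [mem_closedBall, Real.dist_eq, abs_le]
      constructor <;> linarith [hz₂.1, hz₂.2, hy₂.1, hy₂.2, Real.rpow_nonneg hk.le p]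
  have hA' : Tendsto A atTop (v.filterAt z) := by
    refine v.tendsto_filterAt_iff.2
      ⟨Eventually.of_forall fun k => ⟨?_, ?_, 2 * L k, hA k, ?_⟩, fun ε hε => ?_⟩
    · have : IsClosed (parQ n (x k) (L k) ×ˢ Icc (t k) (t k + L k ^ p)) := by
        rw [parQ_eq_closedBall _ (hL k).le]
        exact isClosed_closedBall.prod isClosed_Icc
      exact this
    · have : (interior (parQ n (x k) (L k) ×ˢ Icc (t k) (t k + L k ^ p))).Nonempty := by
        rw [interior_prod_eq, parQ_eq_closedBall _ (hL k).le, interior_Icc]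
        refine Set.Nonempty.prod ⟨x k, ?_⟩ (nonempty_Ioo.2 ?_)
        · exact ball_subset_interior_closedBall (mem_ball_self (half_pos (hL k)))
        · linarith [Real.rpow_pos_of_pos (hL k) p]
      exact this
    · have hk := hL k
      have hvol : volume (A k) = ENNReal.ofReal (L k ^ n * L k ^ p) := by
        change volume (parQ n (x k) (L k) ×ˢ Icc (t k) (t k + L k ^ p)) = _
        rw [Measure.volume_eq_prod, Measure.prod_prod, volume_parQ _ hk.le, Real.volume_Icc,
          ← ENNReal.ofReal_mul (by positivity), add_sub_cancel_left]
      refine (ParabolicSpace.volume_closedBall z (by positivity)).trans_le ?_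
      rw [hvol, hK]
      refine ENNReal.ofReal_le_ofReal (le_of_eq ?_)
      rw [show 2 * (3 * (2 * L k)) = 12 * L k by ring, show 3 * (2 * L k) = 6 * L k by ring,
        mul_pow, Real.mul_rpow (by norm_num) hk.le]
      ring
    · have h0 : Tendsto (fun k => 2 * L k) atTop (𝓝 0) := by simpa using hL0.const_mul 2
      filter_upwards [h0.eventually_le_const hε] with k hk
      exact (hA k).trans (closedBall_subset_closedBall hk)
  refine (hz.comp hA').congr fun k => ?_
  refine setAverage_congr ?_
  change (parQ n (x k) (L k) ×ˢ Icc (t k) (t k + L k ^ p) : Set ((Fin n → ℝ) × ℝ)) =ᵐ[volume] _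
  rw [pPlus, zero_mul, add_zero]
  exact Measure.set_prod_ae_eq (ae_eq_refl _) Ioo_ae_eq_Icc.symm

theorem isClosed_parQ (x : Fin n → ℝ) (L : ℝ) : IsClosed (parQ n x L) := by
  simp only [parQ, ofPred_forall]
  exact isClosed_iInter fun i => isClosed_le (by fun_prop) continuous_const

theorem measurableSet_parQ_prod (x : Fin n → ℝ) (L a b : ℝ) :
    MeasurableSet (parQ n x L ×ˢ Ioo a b) :=
  (isClosed_parQ x L).measurableSet.prod measurableSet_Ioo

theorem integrableOn_parQ_prod {w : (Fin n → ℝ) × ℝ → ℝ} (hw : LocallyIntegrable w volume)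
    (x : Fin n → ℝ) {L : ℝ} (hL : 0 ≤ L) (a b : ℝ) : IntegrableOn w (parQ n x L ×ˢ Ioo a b) := by
  refine (hw.integrableOn_isCompact
    ((isCompact_closedBall x (L / 2)).prod (isCompact_Icc (a := a) (b := b)))).mono_set ?_
  rw [parQ_eq_closedBall x hL]
  exact prod_mono_right Ioo_subset_Icc_self

/-- If a parabolic rectangle lies inside the forward part of a larger one, then the doubling
condition controls the integral over its upper part. -/
theorem setIntegral_pPlus_le {w : (Fin n → ℝ) × ℝ → ℝ} (hw : IsWeight n w) {C : ℝ}
    {x x' : Fin n → ℝ} {t t' L L' : ℝ} (hL' : 0 < L')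
    (hD : (∫ z in pMinus n p 0 x' t' L', w z) ≤ C * ∫ z in pPlus n p 0 x' t' L', w z)
    (hQ : parQ n x L ⊆ parQ n x' L') (h₁ : t' - L' ^ p ≤ t) (h₂ : t + L ^ p ≤ t' + L' ^ p) :
    (∫ z in pPlus n p 0 x t L, w z) ≤ (1 + C) * ∫ z in pPlus n p 0 x' t' L', w z := by
  have hi₁ : IntegrableOn w (pMinus n p 0 x' t' L') := integrableOn_parQ_prod hw.2 _ hL'.le _ _
  have hi₂ : IntegrableOn w (pPlus n p 0 x' t' L') := integrableOn_parQ_prod hw.2 _ hL'.le _ _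
  have hnull : ∀ᵐ z : (Fin n → ℝ) × ℝ, z.2 ≠ t' := by
    have : volume {z : (Fin n → ℝ) × ℝ | z.2 = t'} = 0 := by
      rw [show {z : (Fin n → ℝ) × ℝ | z.2 = t'} = univ ×ˢ {t'} by ext; simp,
        Measure.volume_eq_prod, Measure.prod_prod, Real.volume_singleton, mul_zero]
    simpa [ae_iff] using this
  have hsub : pPlus n p 0 x t L ≤ᵐ[volume]
      (pMinus n p 0 x' t' L' ∪ pPlus n p 0 x' t' L' : Set _) := by
    filter_upwards [hnull] with z hz hzm
    obtain ⟨hz₁, hz₂, hz₃⟩ := hzm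
    simp only [zero_mul, add_zero] at hz₂ hz₃
    rcases lt_or_gt_of_ne hz with h | h
    · refine Or.inl ⟨hQ hz₁, ?_, ?_⟩ <;> linarith
    · refine Or.inr ⟨hQ hz₁, ?_, ?_⟩ <;> linarith
  have hdisj : Disjoint (pMinus n p 0 x' t' L') (pPlus n p 0 x' t' L') := by
    rw [Set.disjoint_left]
    rintro z ⟨-, -, hz⟩ ⟨-, hz', -⟩
    linarith
  calc (∫ z in pPlus n p 0 x t L, w z)
      ≤ ∫ z in pMinus n p 0 x' t' L' ∪ pPlus n p 0 x' t' L', w z :=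
        setIntegral_mono_set (hi₁.union hi₂) (ae_of_all _ hw.1) hsub
    _ = (∫ z in pMinus n p 0 x' t' L', w z) + ∫ z in pPlus n p 0 x' t' L', w z :=
        setIntegral_union hdisj (measurableSet_parQ_prod _ _ _ _) hi₁ hi₂
    _ ≤ _ := by linarith

theorem volume_pPlus (x : Fin n → ℝ) (t : ℝ) {L : ℝ} (hL : 0 ≤ L) :
    volume (pPlus n p 0 x t L) = ENNReal.ofReal (L ^ n * L ^ p) := by
  rw [pPlus, volume_parQ_prod x hL]
  congr 2; ring

theorem setIntegral_le_of_setAverage_le {w : (Fin n → ℝ) × ℝ → ℝ} {x : Fin n → ℝ} {t L lam : ℝ}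
    (hL : 0 < L) (h : (⨍ z in pPlus n p 0 x t L, w z) ≤ lam) :
    (∫ z in pPlus n p 0 x t L, w z) ≤ lam * (L ^ n * L ^ p) := by
  have hpos : 0 < L ^ n * L ^ p := mul_pos (pow_pos hL n) (Real.rpow_pos_of_pos hL p)
  rw [setAverage_eq, measureReal_def, volume_pPlus x t hL.le, ENNReal.toReal_ofReal hpos.le,
    smul_eq_mul, inv_mul_le_iff₀ hpos] at h
  linarith

/-- The number of times the time interval is bisected at the `k`-th generation. -/
def timeExp (p : ℝ) : ℕ → ℕ
  | 0 => 0
  | k + 1 => ⌊((k + 1 : ℕ) : ℝ) * p⌋₊ + 1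

theorem timeExp_le_succ (hp : 0 ≤ p) (k : ℕ) : timeExp p k ≤ timeExp p (k + 1) := by
  cases k with
  | zero => exact Nat.zero_le _
  | succ k =>
    simp only [timeExp]
    gcongr
    lia

/-- The side length of the dyadic cubes of generation `k`. -/
def cellSide (L : ℝ) (k : ℕ) : ℝ := L / 2 ^ k

/-- The duration of the dyadic cells of generation `k`. -/
def cellTime (p L : ℝ) (k : ℕ) : ℝ := L ^ p / 2 ^ timeExp p k

theorem cellSide_pos {L : ℝ} (hL : 0 < L) (k : ℕ) : 0 < cellSide L k := by
  unfold cellSide; positivity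

theorem cellTime_pos {L : ℝ} (hL : 0 < L) (k : ℕ) : 0 < cellTime p L k := by
  have := Real.rpow_pos_of_pos hL p
  unfold cellTime; positivity

theorem two_mul_cellSide_succ (L : ℝ) (k : ℕ) : 2 * cellSide L (k + 1) = cellSide L k := by
  unfold cellSide; field_simp; ring

theorem cellSide_rpow {L : ℝ} (hL : 0 < L) (k : ℕ) :
    cellSide L k ^ p = L ^ p / 2 ^ ((k : ℝ) * p) := by
  rw [cellSide, Real.div_rpow hL.le (by positivity), ← Real.rpow_natCast,
    ← Real.rpow_mul two_pos.le]

theorem cellTime_succ_lt {L : ℝ} (hL : 0 < L) (k : ℕ) :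
    cellTime p L (k + 1) < cellSide L (k + 1) ^ p := by
  have := Real.rpow_pos_of_pos hL p
  have h : (2 : ℝ) ^ (((k + 1 : ℕ) : ℝ) * p) < 2 ^ timeExp p (k + 1) := by
    rw [← Real.rpow_natCast]
    refine Real.rpow_lt_rpow_of_exponent_lt one_lt_two ?_
    rw [timeExp, Nat.cast_succ ⌊_⌋₊]
    exact Nat.lt_floor_add_one _
  rw [cellSide_rpow hL, cellTime]
  gcongr

theorem cellTime_le {L : ℝ} (hL : 0 < L) (k : ℕ) : cellTime p L k ≤ cellSide L k ^ p := by
  cases k with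
  | zero => simp [cellTime, cellSide, timeExp]
  | succ k => exact (cellTime_succ_lt hL k).le

theorem cellSide_rpow_le {L : ℝ} (hp : 0 ≤ p) (hL : 0 < L) (k : ℕ) :
    cellSide L k ^ p ≤ 2 * cellTime p L k := by
  have hT := Real.rpow_pos_of_pos hL p
  cases k with
  | zero => simp only [cellTime, cellSide, timeExp, pow_zero, div_one]; linarith
  | succ k =>
    rw [cellSide_rpow hL, cellTime, timeExp, pow_succ, ← mul_div_assoc, mul_comm 2,
      mul_div_mul_right _ _ two_ne_zero, ← Real.rpow_natCast]
    gcongr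
    · norm_num
    · exact Nat.floor_le (by positivity)

theorem Int.floor_mul_natCast_le (u : ℝ) (d : ℕ) : ⌊u⌋ * d ≤ ⌊u * d⌋ := by
  rw [Int.le_floor]
  push_cast
  gcongr
  exact Int.floor_le u

theorem Int.floor_mul_natCast_add_one_le (u : ℝ) {d : ℕ} (hd : 0 < d) :
    ⌊u * d⌋ + 1 ≤ (⌊u⌋ + 1) * d := by
  rw [Int.add_one_le_iff, Int.floor_lt]
  push_cast
  gcongr
  exact Int.lt_floor_add_one u

theorem Int.floor_eq_of_floor_mul_natCast_eq {u v : ℝ} {d : ℕ} (hd : 0 < d)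
    (h : ⌊u * d⌋ = ⌊v * d⌋) : ⌊u⌋ = ⌊v⌋ := by
  have hd' : (d : ℝ) ≠ 0 := by positivity
  rw [← mul_div_cancel_right₀ u hd', ← mul_div_cancel_right₀ v hd', Int.floor_div_natCast, h,
    Int.floor_div_natCast]

section DyadicGrid

variable (p) (x : Fin n → ℝ) (t L : ℝ)

/-- The index of the dyadic cell of generation `k` containing a point. -/
def gridIdx (k : ℕ) (z : (Fin n → ℝ) × ℝ) : (Fin n → ℤ) × ℤ :=
  (fun i => ⌊(z.1 i - (x i - L / 2)) / L * 2 ^ k⌋,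
    ⌊(z.2 - (t - L ^ p)) / L ^ p * 2 ^ timeExp p k⌋)

/-- The spatial center of a dyadic cell. -/
def cellCenter (k : ℕ) (m : (Fin n → ℤ) × ℤ) : Fin n → ℝ :=
  fun i => x i - L / 2 + (m.1 i + 1 / 2) * cellSide L k

/-- The final time of a dyadic cell. -/
def cellTop (k : ℕ) (m : (Fin n → ℤ) × ℤ) : ℝ :=
  t - L ^ p + (m.2 + 1) * cellTime p L k

/-- The upper part of the parabolic rectangle whose lower part extends a dyadic cell. -/
def cellPlus (k : ℕ) (m : (Fin n → ℤ) × ℤ) : Set ((Fin n → ℝ) × ℝ) :=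
  pPlus n p 0 (cellCenter x L k m) (cellTop p t L k m) (cellSide L k)

/-- The lower part of a parabolic rectangle that contains a given dyadic cell. -/
def cellMinus (k : ℕ) (m : (Fin n → ℤ) × ℤ) : Set ((Fin n → ℝ) × ℝ) :=
  pMinus n p 0 (cellCenter x L k m) (cellTop p t L k m) (cellSide L k)

variable {p x t L}

theorem gridIdx_eq_of_succ (hp : 0 ≤ p) {k : ℕ} {y z : (Fin n → ℝ) × ℝ}
    (h : gridIdx p x t L (k + 1) y = gridIdx p x t L (k + 1) z) :
    gridIdx p x t L k y = gridIdx p x t L k z := by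
  obtain ⟨d, hd⟩ := Nat.exists_eq_add_of_le (timeExp_le_succ hp k)
  simp only [gridIdx, Prod.mk.injEq, funext_iff, hd, pow_add, pow_one, ← mul_assoc] at h ⊢
  refine ⟨fun i => ?_, ?_⟩
  · exact Int.floor_eq_of_floor_mul_natCast_eq two_pos (by exact_mod_cast h.1 i)
  · exact Int.floor_eq_of_floor_mul_natCast_eq (d := 2 ^ d) (by positivity) (by exact_mod_cast h.2)

theorem gridIdx_eq_of_le (hp : 0 ≤ p) {j k : ℕ} (hjk : j ≤ k) {y z : (Fin n → ℝ) × ℝ}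
    (h : gridIdx p x t L k y = gridIdx p x t L k z) :
    gridIdx p x t L j y = gridIdx p x t L j z := by
  induction k, hjk using Nat.le_induction with
  | base => exact h
  | succ k _ ih => exact ih (gridIdx_eq_of_succ hp h)

theorem gridIdx_preimage (hL : 0 < L) (k : ℕ) (m : (Fin n → ℤ) × ℤ) :
    gridIdx p x t L k ⁻¹' {m} =
      (univ.pi fun i => Ico (cellCenter x L k m i - cellSide L k / 2)
        (cellCenter x L k m i + cellSide L k / 2)) ×ˢ
      Ico (cellTop p t L k m - cellTime p L k) (cellTop p t L k m) := by
  have hT := Real.rpow_pos_of_pos hL p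
  have key {T a s : ℝ} {N : ℕ} {q : ℤ} (hT : 0 < T) : ⌊(s - a) / T * 2 ^ N⌋ = q ↔
      a + q * (T / 2 ^ N) ≤ s ∧ s < a + (q + 1) * (T / 2 ^ N) := by
    have h2 : (0 : ℝ) < 2 ^ N := by positivity
    rw [Int.floor_eq_iff, div_mul_eq_mul_div, le_div_iff₀ hT, div_lt_iff₀ hT, mul_div_assoc',
      mul_div_assoc', ← le_sub_iff_add_le', div_le_iff₀ h2, ← sub_lt_iff_lt_add', lt_div_iff₀ h2]
  ext z
  simp only [mem_preimage, mem_singleton_iff, gridIdx, Prod.ext_iff, funext_iff, mem_prod,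
    mem_univ_pi, mem_Ico, key hL, key hT, cellCenter, cellTop, cellTime, cellSide]
  refine and_congr (forall_congr' fun i => ?_) ?_
  · constructor <;> rintro ⟨h₁, h₂⟩ <;> constructor <;> linarith
  · constructor <;> rintro ⟨h₁, h₂⟩ <;> constructor <;> linarith

theorem measurableSet_gridIdx_preimage (hL : 0 < L) (k : ℕ) (m : (Fin n → ℤ) × ℤ) :
    MeasurableSet (gridIdx p x t L k ⁻¹' {m}) := by
  rw [gridIdx_preimage hL]
  exact (MeasurableSet.univ_pi fun _ => measurableSet_Ico).prod measurableSet_Ico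

theorem volume_gridIdx_preimage (hL : 0 < L) (k : ℕ) (m : (Fin n → ℤ) × ℤ) :
    volume (gridIdx p x t L k ⁻¹' {m}) = ENNReal.ofReal (cellSide L k ^ n * cellTime p L k) := by
  have hk := cellSide_pos hL k
  rw [gridIdx_preimage hL, Measure.volume_eq_prod, Measure.prod_prod, Real.volume_pi_Ico,
    Real.volume_Ico, ENNReal.ofReal_mul (by positivity), ENNReal.ofReal_pow hk.le]
  simp only [add_sub_sub_cancel, add_halves, Finset.prod_const, Finset.card_univ, Fintype.card_fin,
    _root_.sub_sub_cancel]

theorem gridIdx_preimage_subset (hL : 0 < L) (k : ℕ) (m : (Fin n → ℤ) × ℤ) :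
    gridIdx p x t L (k + 1) ⁻¹' {m} ⊆ cellMinus p x t L (k + 1) m := by
  rw [gridIdx_preimage hL, cellMinus, pMinus, parQ_eq_pi, zero_mul, sub_zero]
  refine prod_mono (pi_mono fun i _ => Ico_subset_Icc_self) fun s hs => ⟨?_, hs.2⟩
  linarith [hs.1, cellTime_succ_lt (p := p) hL k]

theorem gridIdx_preimage_ae_eq (hL : 0 < L) :
    gridIdx p x t L 0 ⁻¹' {0} =ᵐ[volume] pMinus n p 0 x t L := by
  rw [gridIdx_preimage hL, pMinus, parQ_eq_pi]
  have h₁ (i : Fin n) : cellCenter x L 0 0 i = x i := by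
    simp only [cellCenter, cellSide, Prod.fst_zero, Pi.zero_apply, Int.cast_zero]; ring
  have h₂ : cellTop p t L 0 (0 : (Fin n → ℤ) × ℤ) = t := by
    simp [cellTop, cellTime, timeExp]
  simp only [h₁, h₂, cellSide, cellTime, timeExp, pow_zero, div_one, zero_mul, sub_zero]
  rw [pi_univ_Icc]
  exact Measure.set_prod_ae_eq Measure.univ_pi_Ico_ae_eq_Icc Ioo_ae_eq_Ico.symm

theorem cellPlus_zero : cellPlus p x t L 0 (0 : (Fin n → ℤ) × ℤ) = pPlus n p 0 x t L := by
  have h₁ : cellCenter x L 0 0 = x := by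
    ext i
    simp only [cellCenter, cellSide, Prod.fst_zero, Pi.zero_apply, Int.cast_zero]; ring
  simp [cellPlus, h₁, cellTop, cellTime, timeExp, cellSide]

theorem parQ_cellCenter_subset (hL : 0 < L) (k : ℕ) (z : (Fin n → ℝ) × ℝ) :
    parQ n (cellCenter x L (k + 1) (gridIdx p x t L (k + 1) z)) (cellSide L (k + 1)) ⊆
      parQ n (cellCenter x L k (gridIdx p x t L k z)) (cellSide L k) := by
  have hk := cellSide_pos hL (k + 1)
  rw [parQ_eq_pi, parQ_eq_pi]
  refine pi_mono fun i _ => Icc_subset_Icc ?_ ?_ <;>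
  simp only [cellCenter, gridIdx, ← two_mul_cellSide_succ L k, pow_succ _ k, ← mul_assoc]
  · have := Int.floor_mul_natCast_le ((z.1 i - (x i - L / 2)) / L * 2 ^ k) 2
    push_cast at this
    have := mul_le_mul_of_nonneg_right (Int.cast_le (R := ℝ).2 this) hk.le
    push_cast at this
    linarith
  · have := Int.floor_mul_natCast_add_one_le ((z.1 i - (x i - L / 2)) / L * 2 ^ k) two_pos
    push_cast at this
    have := mul_le_mul_of_nonneg_right (Int.cast_le (R := ℝ).2 this) hk.le
    push_cast at this
    linarith

theorem cellTop_bounds (hp : 0 ≤ p) (hL : 0 < L) (k : ℕ) (z : (Fin n → ℝ) × ℝ) :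
    cellTop p t L k (gridIdx p x t L k z) - cellTime p L k ≤
        cellTop p t L (k + 1) (gridIdx p x t L (k + 1) z) ∧
      cellTop p t L (k + 1) (gridIdx p x t L (k + 1) z) ≤
        cellTop p t L k (gridIdx p x t L k z) := by
  have hk := cellTime_pos (p := p) hL (k + 1)
  obtain ⟨d, hd⟩ := Nat.exists_eq_add_of_le (timeExp_le_succ hp k)
  have hT : cellTime p L k = (2 : ℝ) ^ d * cellTime p L (k + 1) := by
    rw [cellTime, cellTime, hd, pow_add]; field_simp
  simp only [cellTop, gridIdx, hT]
  rw [hd, pow_add, ← mul_assoc _ (2 ^ timeExp p k) (2 ^ d)]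
  set u := (z.2 - (t - L ^ p)) / L ^ p * 2 ^ timeExp p k
  have h₁ := Int.floor_mul_natCast_le u (2 ^ d)
  have h₂ := Int.floor_mul_natCast_add_one_le u (d := 2 ^ d) (by positivity)
  push_cast at h₁ h₂
  have h₁ := mul_le_mul_of_nonneg_right (Int.cast_le (R := ℝ).2 h₁) hk.le
  have h₂ := mul_le_mul_of_nonneg_right (Int.cast_le (R := ℝ).2 h₂) hk.le
  push_cast at h₁ h₂
  constructor <;> linarith

/-- If the average over the forward rectangle of the parent is at most `lam`, then so is, up to a
constant, the average over a dyadic cell. -/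
theorem setIntegral_cell_le {w : (Fin n → ℝ) × ℝ → ℝ} (hp : 0 ≤ p) (hw : IsWeight n w)
    {C : ℝ} (hC : 0 < C)
    (hD : ∀ (x : Fin n → ℝ) (t L : ℝ), 0 < L →
      (∫ z in pMinus n p 0 x t L, w z) ≤ C * ∫ z in pPlus n p 0 x t L, w z)
    (hL : 0 < L) {k : ℕ} {z : (Fin n → ℝ) × ℝ} {lam : ℝ} (hlam : 0 ≤ lam)
    (h : (⨍ y in cellPlus p x t L k (gridIdx p x t L k z), w y) ≤ lam) :
    (∫ y in gridIdx p x t L (k + 1) ⁻¹' {gridIdx p x t L (k + 1) z}, w y) ≤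
      C * (1 + C) * (2 ^ n * 2 ^ p * 2) * lam *
        (cellSide L (k + 1) ^ n * cellTime p L (k + 1)) := by
  have hk := cellSide_pos hL k
  have hk' := cellSide_pos hL (k + 1)
  obtain ⟨hb₁, hb₂⟩ := cellTop_bounds (x := x) (t := t) hp hL k z
  have hcube := parQ_cellCenter_subset (p := p) (x := x) (t := t) hL k z
  have hpow : cellSide L (k + 1) ^ p ≤ cellSide L k ^ p := by
    rw [← two_mul_cellSide_succ L k]
    exact Real.rpow_le_rpow hk'.le (by linarith) hp
  calc (∫ y in gridIdx p x t L (k + 1) ⁻¹' {gridIdx p x t L (k + 1) z}, w y)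
      ≤ ∫ y in cellMinus p x t L (k + 1) (gridIdx p x t L (k + 1) z), w y :=
        setIntegral_mono_set (integrableOn_parQ_prod hw.2 _ hk'.le _ _) (ae_of_all _ hw.1)
          (gridIdx_preimage_subset hL k _).eventuallyLE
    _ ≤ C * ∫ y in cellPlus p x t L (k + 1) (gridIdx p x t L (k + 1) z), w y := hD _ _ _ hk'
    _ ≤ C * ((1 + C) * ∫ y in cellPlus p x t L k (gridIdx p x t L k z), w y) := by
        gcongr
        refine setIntegral_pPlus_le hw hk (hD _ _ _ hk) hcube ?_ (by linarith)
        linarith [cellTime_le (p := p) hL k]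
    _ ≤ C * ((1 + C) * (lam * (cellSide L k ^ n * cellSide L k ^ p))) := by
        gcongr
        exact setIntegral_le_of_setAverage_le hk h
    _ ≤ C * ((1 + C) * (lam * ((2 ^ n * cellSide L (k + 1) ^ n) *
          (2 ^ p * (2 * cellTime p L (k + 1)))))) := by
        rw [← two_mul_cellSide_succ L k, mul_pow, Real.mul_rpow two_pos.le hk'.le]
        gcongr
        exact cellSide_rpow_le hp hL (k + 1)
    _ = _ := by ring

end DyadicGrid

theorem ofReal_lt_Mplus {w : (Fin n → ℝ) × ℝ → ℝ} (hw : ∀ z, 0 ≤ w z) {x : Fin n → ℝ}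
    {t L lam : ℝ} (hL : 0 < L) (hlam : 0 ≤ lam) {z : (Fin n → ℝ) × ℝ}
    (hz : z ∈ pMinus n p 0 x t L) (h : lam < ⨍ y in pPlus n p 0 x t L, w y) :
    ENNReal.ofReal lam < Mplus n p w z := by
  refine ((ENNReal.ofReal_lt_ofReal_iff_of_nonneg hlam).2 h).trans_le ?_
  simp only [Mplus, abs_of_nonneg (hw _)]
  exact le_iSup_of_le x <| le_iSup_of_le t <| le_iSup_of_le L <| le_iSup_of_le hL <|
    le_iSup_of_le hz le_rfl

/-- Reverse weak type estimate for the parabolic maximal function. -/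
theorem stmt_13 (n : ℕ) (p : ℝ) (hp : 1 < p)
    (w : (Fin n → ℝ) × ℝ → ℝ) (hw : IsWeight n w)
    (C : ℝ) (hC : 0 < C)
    (hD : ∀ (x : Fin n → ℝ) (t L : ℝ), 0 < L →
      (∫ z in pMinus n p 0 x t L, w z) ≤ C * ∫ z in pPlus n p 0 x t L, w z) :
    ∃ c > (0 : ℝ), ∀ (x : Fin n → ℝ) (t L : ℝ), 0 < L → ∀ lam : ℝ,
      (⨍ z in pPlus n p 0 x t L, w z) ≤ lam →
      (∫ z in pMinus n p 0 x t L ∩ {z | lam < w z}, w z) ≤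
        c * lam * (volume (pMinus n p 0 x t L ∩
          {z | ENNReal.ofReal lam < Mplus n p w z})).toReal := by
  have hp0 : 0 ≤ p := (zero_lt_one.trans hp).le
  refine ⟨C * (1 + C) * (2 ^ n * 2 ^ p * 2), by positivity, fun x t L hL lam hle => ?_⟩
  set c := C * (1 + C) * ((2 : ℝ) ^ n * 2 ^ p * 2)
  have hc : 0 ≤ c := by positivity
  have hlam : 0 ≤ lam := by
    refine le_trans ?_ hle
    rw [setAverage_eq]
    exact smul_nonneg (by positivity) (integral_nonneg hw.1)
  let idx := gridIdx p x t L
  let cell : ℕ × ((Fin n → ℤ) × ℤ) → Set ((Fin n → ℝ) × ℝ) := fun σ => idx σ.1 ⁻¹' {σ.2}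
  let bad : ℕ → (Fin n → ℝ) × ℝ → Prop := fun k z => lam < ⨍ y in cellPlus p x t L k (idx k z), w y
  let J : Set (ℕ × ((Fin n → ℤ) × ℤ)) :=
    {σ | ∃ z, idx 0 z = 0 ∧ idx σ.1 z = σ.2 ∧ bad σ.1 z ∧ ∀ j < σ.1, ¬ bad j z}
  have hbad0 {z} (hz : idx 0 z = 0) : ¬ bad 0 z := by
    simp only [bad, hz, cellPlus_zero, not_lt]
    exact hle
  have hJ {σ} (hσ : σ ∈ J) {y} (hy : y ∈ cell σ) :
      idx 0 y = 0 ∧ bad σ.1 y ∧ ∀ j < σ.1, ¬ bad j y := by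
    obtain ⟨z, hz0, hzσ, hzb, hzj⟩ := hσ
    have hyz {j} (hj : j ≤ σ.1) : idx j y = idx j z := gridIdx_eq_of_le hp0 hj (hy.trans hzσ.symm)
    refine ⟨(hyz (Nat.zero_le _)).trans hz0, ?_, fun j hj => ?_⟩
    · simpa only [bad, hyz le_rfl] using hzb
    · simpa only [bad, hyz hj.le] using hzj j hj
  have hne {σ} (hσ : σ ∈ J) : ∃ k, σ.1 = k + 1 := by
    obtain ⟨z, hz0, -, hzb, -⟩ := hσ
    refine Nat.exists_eq_succ_of_ne_zero fun h => hbad0 hz0 ?_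
    rwa [h] at hzb
  have hdisj : J.PairwiseDisjoint cell := by
    refine fun σ hσ τ hτ hne => Set.disjoint_left.2 fun y hyσ hyτ => hne ?_
    obtain ⟨-, hσb, hσj⟩ := hJ hσ hyσ
    obtain ⟨-, hτb, hτj⟩ := hJ hτ hyτ
    have h : σ.1 = τ.1 :=
      le_antisymm (not_lt.1 fun h => hσj _ h hτb) (not_lt.1 fun h => hτj _ h hσb)
    exact Prod.ext h (by rw [← show idx σ.1 y = σ.2 from hyσ, ← show idx τ.1 y = τ.2 from hyτ, h])
  have hmeas (σ) : MeasurableSet (cell σ) := measurableSet_gridIdx_preimage hL _ _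
  have hcell {σ} (hσ : σ ∈ J) :
      ∫⁻ z in cell σ, ENNReal.ofReal (w z) ≤ ENNReal.ofReal (c * lam) * volume (cell σ) := by
    obtain ⟨k, hk⟩ := hne hσ
    obtain ⟨z, -, hzσ, -, hzj⟩ := hσ
    obtain ⟨k', m⟩ := σ
    obtain rfl : k' = k + 1 := hk
    obtain rfl : idx (k + 1) z = m := hzσ
    have hint : IntegrableOn w (cell (k + 1, idx (k + 1) z)) :=
      (integrableOn_parQ_prod hw.2 _ (cellSide_pos hL _).le _ _).mono_set
        (gridIdx_preimage_subset hL k _)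
    rw [volume_gridIdx_preimage hL, ← ENNReal.ofReal_mul (by positivity),
      ← ofReal_integral_eq_lintegral_ofReal hint (ae_of_all _ hw.1)]
    exact ENNReal.ofReal_le_ofReal
      (setIntegral_cell_le hp0 hw hC hD hL hlam (not_lt.1 (hzj k k.lt_succ_self)))
  let U := ⋃ σ ∈ J, cell σ
  have hUbase : U ≤ᵐ[volume] pMinus n p 0 x t L := by
    refine Filter.EventuallyLE.trans_eq (LE.le.eventuallyLE ?_) (gridIdx_preimage_ae_eq hL)
    exact iUnion₂_subset fun σ hσ y hy => (hJ hσ hy).1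
  have hUM : U ⊆ {z | ENNReal.ofReal lam < Mplus n p w z} := by
    refine iUnion₂_subset fun σ hσ y hy => ?_
    obtain ⟨k, hk⟩ := hne hσ
    have hb := (hJ hσ hy).2.1
    rw [hk] at hb
    exact ofReal_lt_Mplus hw.1 (cellSide_pos hL _) hlam (gridIdx_preimage_subset hL k _ rfl) hb
  have hUw : ∫⁻ z in U, ENNReal.ofReal (w z) ≤ ENNReal.ofReal (c * lam) * volume U := by
    calc ∫⁻ z in U, ENNReal.ofReal (w z)
        = ∑' σ : J, ∫⁻ z in cell σ, ENNReal.ofReal (w z) :=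
          lintegral_biUnion J.to_countable (fun σ _ => hmeas σ) hdisj _
      _ ≤ ∑' σ : J, ENNReal.ofReal (c * lam) * volume (cell σ) :=
          ENNReal.tsum_le_tsum fun σ => hcell σ.2
      _ = _ := by
          rw [ENNReal.tsum_mul_left, measure_biUnion J.to_countable hdisj fun σ _ => hmeas σ]
  have hcover : (pMinus n p 0 x t L ∩ {z | lam < w z} : Set _) ≤ᵐ[volume] U := by
    filter_upwards [ae_tendsto_average_pPlus hp hw.2, (gridIdx_preimage_ae_eq (p := p) (x := x)
      (t := t) hL).mem_iff] with z hz hzbase hzD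
    have hz0 : idx 0 z = 0 := hzbase.2 hzD.1
    have hside : Tendsto (fun k => cellSide L (k + 1)) atTop (𝓝 0) := by
      have := (tendsto_pow_atTop_atTop_of_one_lt (one_lt_two (α := ℝ))).const_div_atTop L
      exact (tendsto_add_atTop_iff_nat 1).2 this
    have hlim := hz _ _ _ (fun k => cellSide_pos hL (k + 1)) hside
      fun k => gridIdx_preimage_subset hL k (idx (k + 1) z) rfl
    obtain ⟨k, hk⟩ := (hlim.eventually_const_lt hzD.2).exists
    classical
    have hex : ∃ k, bad k z := ⟨k + 1, hk⟩
    exact mem_biUnion (show (Nat.find hex, idx (Nat.find hex) z) ∈ J from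
      ⟨z, hz0, rfl, Nat.find_spec hex, fun j => Nat.find_min hex⟩) rfl
  have hint : IntegrableOn w (pMinus n p 0 x t L) := integrableOn_parQ_prod hw.2 _ hL.le _ _
  have hfin : volume (pMinus n p 0 x t L) ≠ ∞ := by
    rw [pMinus, volume_parQ_prod x hL.le]; exact ENNReal.ofReal_ne_top
  have hintU : IntegrableOn w U := hint.mono_set_ae hUbase
  have hUfin : volume U ≠ ∞ := ne_top_of_le_ne_top hfin (measure_mono_ae hUbase)
  calc (∫ z in pMinus n p 0 x t L ∩ {z | lam < w z}, w z)
      ≤ ∫ z in U, w z := setIntegral_mono_set hintU (ae_of_all _ hw.1) hcover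
    _ = (∫⁻ z in U, ENNReal.ofReal (w z)).toReal :=
        integral_eq_lintegral_of_nonneg_ae (ae_of_all _ hw.1) hintU.aestronglyMeasurable
    _ ≤ (ENNReal.ofReal (c * lam) * volume U).toReal :=
        ENNReal.toReal_mono (ENNReal.mul_ne_top ENNReal.ofReal_ne_top hUfin) hUw
    _ = c * lam * (volume U).toReal := by
        rw [ENNReal.toReal_mul, ENNReal.toReal_ofReal (by positivity)]
    _ ≤ _ := by
        refine mul_le_mul_of_nonneg_left (ENNReal.toReal_mono
          (ne_top_of_le_ne_top hfin (measure_mono inter_subset_left)) (measure_mono_ae ?_))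
          (by positivity)
        filter_upwards [hUbase] with z hz hzU
        exact ⟨hz hzU, hUM hzU⟩
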